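/- arXiv:2211.03833 — 2 statements merged into one kernel-verified Lean document; each statement's English description precedes it below -/
import Mathlib

section
/- For each υ, σ ∈ {0,1}, the canonical maps 𝒪_q(Mat_N) → 𝒜_{υσ} (sending t_{ij} to the class of t_{ij}) and 𝒪_q(Mat_N)^op → 𝒜_{υσ} (sending ∂_{ij} to the class of ∂_{ij}) are well-defined k-algebra homomorphisms, and the k-linear map 𝒪_q(Mat_N) ⊗_k 𝒪_q(Mat_N)^op → 𝒜_{υσ} sending f ⊗ g to the product of the canonical images of f and g is a bijection; in other words, 𝒜_{υσ} is a twisted tensor product of 𝒪_q(Mat_N) and 𝒪_q(Mat_N)^op with twisting map determined by ∂_{ea} t_{fb} ↦ Σ_{j,m,d,l} (R_σ^{t₂})^{dl}_{fe} (R_υ^{t₂})^{jm}_{ba} t_{dj} ∂_{lm}. -/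
open scoped BigOperators TensorProduct

noncomputable section

abbrev K : Type := RatFunc ℂ

def q : K := RatFunc.X

/-- The standard R-matrix of `U_q(gl_N)`: the coefficient of `e_{ik} ⊗ e_{jl}` is the
entry at row `(i,j)`, column `(k,l)`. -/
def Rmat (N : ℕ) : Matrix (Fin N × Fin N) (Fin N × Fin N) K :=
  Matrix.of fun p c =>
    if p.1 = c.1 ∧ p.2 = c.2 then (if p.1 = p.2 then q else 1)
    else if p.1 = c.2 ∧ p.2 = c.1 ∧ c.1 < p.1 then q - q⁻¹
    else 0

/-- partial transpose in the first tensor factor -/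
def pt1 {N : ℕ} {α : Type} (C : Matrix (Fin N × Fin N) (Fin N × Fin N) α) :
    Matrix (Fin N × Fin N) (Fin N × Fin N) α :=
  Matrix.of fun p c => C (c.1, p.2) (p.1, c.2)

/-- partial transpose in the second tensor factor -/
def pt2 {N : ℕ} {α : Type} (C : Matrix (Fin N × Fin N) (Fin N × Fin N) α) :
    Matrix (Fin N × Fin N) (Fin N × Fin N) α :=
  Matrix.of fun p c => C (p.1, c.2) (c.1, p.2)

/-- flip of the two tensor factors -/
def flip21 {N : ℕ} {α : Type} (C : Matrix (Fin N × Fin N) (Fin N × Fin N) α) :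
    Matrix (Fin N × Fin N) (Fin N × Fin N) α :=
  Matrix.of fun p c => C (p.2, p.1) (c.2, c.1)

/-- `R₀ = R` and `R₁ = R₂₁⁻¹`. -/
def Rv (N : ℕ) (i : Fin 2) : Matrix (Fin N × Fin N) (Fin N × Fin N) K :=
  if i = 0 then Rmat N else (flip21 (Rmat N))⁻¹

/-- the generator `t_{ij}` of the free algebra -/
def Tg {n : ℕ} (i j : Fin n) : FreeAlgebra K (Fin n × Fin n) := FreeAlgebra.ι K (i, j)

/-- defining relations of `𝒪_q(Mat_n)` -/
inductive matRel (n : ℕ) :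
    FreeAlgebra K (Fin n × Fin n) → FreeAlgebra K (Fin n × Fin n) → Prop
  | rowq (l i j : Fin n) (h : i < j) :
      matRel n (Tg l i * Tg l j) (q • (Tg l j * Tg l i))
  | colq (l i j : Fin n) (h : i < j) :
      matRel n (Tg i l * Tg j l) (q • (Tg j l * Tg i l))
  | anti (i k j l : Fin n) (h1 : i < k) (h2 : j < l) :
      matRel n (Tg i l * Tg k j) (Tg k j * Tg i l)
  | main (i k j l : Fin n) (h1 : i < k) (h2 : j < l) :
      matRel n (Tg i j * Tg k l) (Tg k l * Tg i j + (q - q⁻¹) • (Tg k j * Tg i l))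

/-- the quantized function algebra `𝒪_q(Mat_n)` -/
abbrev OqMat (n : ℕ) := RingQuot (matRel n)

/-- the generator `t_{ij}` of `𝒪_q(Mat_n)` -/
def tGen {n : ℕ} (i j : Fin n) : OqMat n :=
  RingQuot.mkAlgHom K (matRel n) (Tg i j)

/-- defining relations of `𝒪_q(Mat_n)^{op}` (generators `∂_{ij}`) -/
inductive matRelOp (n : ℕ) :
    FreeAlgebra K (Fin n × Fin n) → FreeAlgebra K (Fin n × Fin n) → Prop
  | rowq (l i j : Fin n) (h : i < j) :
      matRelOp n (Tg l j * Tg l i) (q • (Tg l i * Tg l j))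
  | colq (l i j : Fin n) (h : i < j) :
      matRelOp n (Tg j l * Tg i l) (q • (Tg i l * Tg j l))
  | anti (i k j l : Fin n) (h1 : i < k) (h2 : j < l) :
      matRelOp n (Tg k j * Tg i l) (Tg i l * Tg k j)
  | main (i k j l : Fin n) (h1 : i < k) (h2 : j < l) :
      matRelOp n (Tg k l * Tg i j) (Tg i j * Tg k l + (q - q⁻¹) • (Tg i l * Tg k j))

/-- the opposite quantized function algebra -/
abbrev OqMatOp (n : ℕ) := RingQuot (matRelOp n)

/-- the generator `∂_{ij}` of `𝒪_q(Mat_n)^{op}` -/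
def pGen {n : ℕ} (i j : Fin n) : OqMatOp n :=
  RingQuot.mkAlgHom K (matRelOp n) (Tg i j)

/-- the generator `t_{ij}` inside the big free algebra -/
def tF {N : ℕ} (i j : Fin N) : FreeAlgebra K ((Fin N × Fin N) ⊕ (Fin N × Fin N)) :=
  FreeAlgebra.ι K (Sum.inl (i, j))

/-- the generator `∂_{ij}` inside the big free algebra -/
def dF {N : ℕ} (i j : Fin N) : FreeAlgebra K ((Fin N × Fin N) ⊕ (Fin N × Fin N)) :=
  FreeAlgebra.ι K (Sum.inr (i, j))

/-- the defining relations of the twisted tensor product algebra `𝒜_{υσ}` -/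
inductive ttRel (N : ℕ) (υ σ : Fin 2) :
    FreeAlgebra K ((Fin N × Fin N) ⊕ (Fin N × Fin N)) →
      FreeAlgebra K ((Fin N × Fin N) ⊕ (Fin N × Fin N)) → Prop
  | trowq (l i j : Fin N) (h : i < j) :
      ttRel N υ σ (tF l i * tF l j) (q • (tF l j * tF l i))
  | tcolq (l i j : Fin N) (h : i < j) :
      ttRel N υ σ (tF i l * tF j l) (q • (tF j l * tF i l))
  | tanti (i k j l : Fin N) (h1 : i < k) (h2 : j < l) :
      ttRel N υ σ (tF i l * tF k j) (tF k j * tF i l)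
  | tmain (i k j l : Fin N) (h1 : i < k) (h2 : j < l) :
      ttRel N υ σ (tF i j * tF k l) (tF k l * tF i j + (q - q⁻¹) • (tF k j * tF i l))
  | drowq (l i j : Fin N) (h : i < j) :
      ttRel N υ σ (dF l j * dF l i) (q • (dF l i * dF l j))
  | dcolq (l i j : Fin N) (h : i < j) :
      ttRel N υ σ (dF j l * dF i l) (q • (dF i l * dF j l))
  | danti (i k j l : Fin N) (h1 : i < k) (h2 : j < l) :
      ttRel N υ σ (dF k j * dF i l) (dF i l * dF k j)
  | dmain (i k j l : Fin N) (h1 : i < k) (h2 : j < l) :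
      ttRel N υ σ (dF k l * dF i j) (dF i j * dF k l + (q - q⁻¹) • (dF i l * dF k j))
  | cross (e a f b : Fin N) :
      ttRel N υ σ (dF e a * tF f b)
        (∑ d : Fin N, ∑ l : Fin N, ∑ j : Fin N, ∑ m : Fin N,
          (pt2 (Rv N σ) (d, l) (f, e) * pt2 (Rv N υ) (j, m) (b, a)) • (tF d j * dF l m))

/-- the twisted tensor product algebra `𝒜_{υσ}` -/
abbrev Att (N : ℕ) (υ σ : Fin 2) := RingQuot (ttRel N υ σ)

/-- the class of `t_{ij}` in `𝒜_{υσ}` -/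
def tAtt (N : ℕ) (υ σ : Fin 2) (i j : Fin N) : Att N υ σ :=
  RingQuot.mkAlgHom K (ttRel N υ σ) (tF i j)

/-- the class of `∂_{ij}` in `𝒜_{υσ}` -/
def dAtt (N : ℕ) (υ σ : Fin 2) (i j : Fin N) : Att N υ σ :=
  RingQuot.mkAlgHom K (ttRel N υ σ) (dF i j)

/-- The relations of `𝒪_q(Mat_N)` for a family of elements of an algebra. -/
structure QRel {N : ℕ} {S : Type*} [Ring S] [Algebra K S] (T : Fin N → Fin N → S) : Prop where
  rowq : ∀ l i j, i < j → T l i * T l j = q • (T l j * T l i)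
  colq : ∀ l i j, i < j → T i l * T j l = q • (T j l * T i l)
  anti : ∀ i k j l, i < k → j < l → T i l * T k j = T k j * T i l
  main : ∀ i k j l, i < k → j < l →
    T i j * T k l = T k l * T i j + (q - q⁻¹) • (T k j * T i l)

/-- The diagonal coefficients of the R-matrix. -/
def rdiag {N : ℕ} (i j : Fin N) : K := if i = j then q else 1

/-- The off-diagonal coefficients of the R-matrix. -/
def roff {N : ℕ} (i j : Fin N) : K := if j < i then q - q⁻¹ else 0

lemma q_ne_zero : q ≠ 0 := RatFunc.X_ne_zero

/-- Invariance of a four-index family under exchange of its index pairs by the R-matrix. -/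
def Braided {N : ℕ} {M : Type*} [AddCommGroup M] [Module K M]
    (F : Fin N → Fin N → Fin N → Fin N → M) : Prop :=
  ∀ f f' b b', rdiag f f' • F f b f' b' + roff f f' • F f' b f b' =
    rdiag b b' • F f' b' f b + roff b' b • F f' b f b'

/-- The relation `R T₁ T₂ = T₂ T₁ R` in components. -/
def RTT {N : ℕ} {S : Type*} [Ring S] [Algebra K S] (T : Fin N → Fin N → S) : Prop :=
  Braided fun f b f' b' => T f b * T f' b'

section Algebra

variable {N : ℕ} {S : Type*} [Ring S] [Algebra K S]

lemma QRel.transpose {T : Fin N → Fin N → S} (h : QRel T) : QRel (fun i j => T j i) where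
  rowq := h.colq
  colq := h.rowq
  anti i k j l h1 h2 := (h.anti j l i k h2 h1).symm
  main i k j l h1 h2 := by rw [h.main j l i k h2 h1, h.anti j l i k h2 h1]

lemma RTT.qRel {T : Fin N → Fin N → S} (h : RTT T) : QRel T where
  rowq l i j hij := by
    have h1 := h l l i j
    simp only [rdiag, roff, if_true, lt_irrefl, if_false, hij, hij.ne, zero_smul,
      add_zero, one_smul, sub_smul] at h1
    have h2 : q⁻¹ • (T l i * T l j) = T l j * T l i := by
      rw [← add_right_cancel_iff (a := q • (T l i * T l j) - q⁻¹ • (T l i * T l j)), ← h1]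
      abel
    rw [← h2, smul_inv_smul₀ q_ne_zero]
  colq l i j hij := by
    have h1 := h i j l l
    simp only [rdiag, roff, if_true, lt_irrefl, if_false, hij.ne, hij.not_gt, zero_smul,
      add_zero, one_smul] at h1
    exact h1
  anti i k j l h1 h2 := by
    have h3 := h i k l j
    simp only [rdiag, roff, if_false, h1.ne, h1.not_gt, h2.ne', h2.not_gt, zero_smul,
      add_zero, one_smul] at h3
    exact h3
  main i k j l h1 h2 := by
    have h3 := h i k j l
    simp only [rdiag, roff, if_true, if_false, h1.ne, h1.not_gt, h2.ne, h2, zero_smul,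
      add_zero, one_smul] at h3
    exact h3

lemma QRel.rtt {T : Fin N → Fin N → S} (h : QRel T) : RTT T := by
  intro f f' b b'
  rcases lt_trichotomy f f' with hf | rfl | hf <;> rcases lt_trichotomy b b' with hb | rfl | hb
  · simp only [rdiag, roff, if_true, if_false, hf.ne, hf.not_gt, hb.ne, hb, zero_smul,
      add_zero, one_smul]
    exact h.main _ _ _ _ hf hb
  · simp only [rdiag, roff, if_true, if_false, hf.ne, hf.not_gt, lt_irrefl, zero_smul,
      add_zero, one_smul]
    exact h.colq _ _ _ hf
  · simp only [rdiag, roff, if_false, hf.ne, hf.not_gt, hb.ne', hb.not_gt, zero_smul,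
      add_zero, one_smul]
    exact h.anti _ _ _ _ hf hb
  · simp only [rdiag, roff, if_true, lt_irrefl, if_false, hb, hb.ne, zero_smul, add_zero, one_smul]
    rw [h.rowq _ _ _ hb, sub_smul, smul_smul q⁻¹, inv_mul_cancel₀ q_ne_zero]
    rw [one_smul, add_sub_cancel]
  · simp [rdiag, roff]
  · simp only [rdiag, roff, if_true, lt_irrefl, if_false, hb.not_gt, hb.ne', zero_smul, add_zero,
      one_smul]
    exact (h.rowq _ _ _ hb).symm
  · simp only [rdiag, roff, if_true, if_false, hf.ne', hf, hb.ne, hb, one_smul]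
    rw [h.anti _ _ _ _ hf hb]
  · simp only [rdiag, roff, if_true, if_false, hf.ne', hf, lt_irrefl, one_smul, zero_smul,
      add_zero]
    rw [h.colq _ _ _ hf, sub_smul, smul_smul q⁻¹, inv_mul_cancel₀ q_ne_zero]
    rw [one_smul, add_sub_cancel]
  · simp only [rdiag, roff, if_true, if_false, hf.ne', hf, hb.ne', hb.not_gt, one_smul, zero_smul,
      add_zero]
    rw [h.main _ _ _ _ hf hb, h.anti _ _ _ _ hf hb]

lemma Braided.map {M M' : Type*} [AddCommGroup M] [Module K M] [AddCommGroup M'] [Module K M']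
    {F : Fin N → Fin N → Fin N → Fin N → M} (hF : Braided F) (φ : M →ₗ[K] M') :
    Braided fun f b f' b' => φ (F f b f' b') := by
  intro f f' b b'
  simpa only [map_add, map_smul] using congrArg φ (hF f f' b b')

lemma Braided.add {M : Type*} [AddCommGroup M] [Module K M]
    {F G : Fin N → Fin N → Fin N → Fin N → M} (hF : Braided F) (hG : Braided G) :
    Braided fun f b f' b' => F f b f' b' + G f b f' b' := by
  intro f f' b b'
  simp only [smul_add]
  rw [add_add_add_comm, hF, hG, add_add_add_comm]

lemma Braided.mul {F G : Fin N → Fin N → Fin N → Fin N → S} (hF : Braided F) (hG : Braided G) :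
    Braided fun f b f' b' => ∑ s, ∑ s', F f s f' s' * G s b s' b' := by
  intro f f' b b'
  simp only [Finset.smul_sum]
  rw [Finset.sum_comm (f := fun s s' => rdiag b b' • (F f' s f s' * G s b' s' b))]
  simp only [← Finset.sum_add_distrib]
  calc ∑ s, ∑ s', (rdiag f f' • (F f s f' s' * G s b s' b') +
        roff f f' • (F f' s f s' * G s b s' b'))
      = ∑ s, ∑ s', (rdiag s s' • (F f' s' f s * G s b s' b') +
        roff s' s • (F f' s f s' * G s b s' b')) := by
        refine Finset.sum_congr rfl fun s _ => Finset.sum_congr rfl fun s' _ => ?_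
        simpa only [add_mul, smul_mul_assoc] using
          congrArg (· * G s b s' b') (hF f f' s s')
    _ = ∑ s, ∑ s', (rdiag s' s • (F f' s f s' * G s' b s b') +
        roff s' s • (F f' s f s' * G s b s' b')) := by
        simp only [Finset.sum_add_distrib]
        rw [Finset.sum_comm]
    _ = ∑ s, ∑ s', (rdiag b b' • (F f' s f s' * G s b' s' b) +
        roff b' b • (F f' s f s' * G s b s' b')) := by
        refine Finset.sum_congr rfl fun s _ => Finset.sum_congr rfl fun s' _ => ?_
        simpa only [mul_add, mul_smul_comm] using
          congrArg (F f' s f s' * ·) (hG s' s b b')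
    _ = _ := by
        simp only [Finset.sum_add_distrib]
        rw [Finset.sum_comm (f := fun s s' => rdiag b b' • (F f' s f s' * G s b' s' b))]

lemma RTT.mul {T T' : Fin N → Fin N → S} (h : RTT T) (h' : RTT T')
    (hc : ∀ i j k l, T' i j * T k l = T k l * T' i j) :
    RTT (fun i j => ∑ k, T i k * T' k j) := by
  have e : ∀ i j k l, (∑ s, T i s * T' s j) * (∑ s, T k s * T' s l) =
      ∑ s, ∑ s', (T i s * T k s') * (T' s j * T' s' l) := by
    intro i j k l
    rw [Finset.sum_mul_sum]
    refine Finset.sum_congr rfl fun s _ => Finset.sum_congr rfl fun s' _ => ?_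
    rw [mul_assoc, ← mul_assoc (T' s j), hc, mul_assoc, mul_assoc]
  simpa only [RTT, e] using Braided.mul h h'

lemma RTT.map {S' : Type*} [Ring S'] [Algebra K S'] {T : Fin N → Fin N → S} (h : RTT T)
    (φ : S →ₐ[K] S') : RTT (fun i j => φ (T i j)) := by
  simpa only [RTT, AlgHom.toLinearMap_apply, map_mul] using Braided.map h φ.toLinearMap

lemma RTT.transpose {T : Fin N → Fin N → S} (h : RTT T) : RTT (fun i j => T j i) :=
  h.qRel.transpose.rtt

end Algebra

/-- Entries of `(R₂₁)⁻¹`. -/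
def Rinv (N : ℕ) : Matrix (Fin N × Fin N) (Fin N × Fin N) K :=
  Matrix.of fun p c =>
    if p.1 = c.1 ∧ p.2 = c.2 then (if p.1 = p.2 then q⁻¹ else 1)
    else if p.1 = c.2 ∧ p.2 = c.1 ∧ p.1 < c.1 then q⁻¹ - q
    else 0

lemma flip_mul_Rinv (N : ℕ) : flip21 (Rmat N) * Rinv N = 1 := by
  have hq := q_ne_zero
  ext ⟨i, j⟩ ⟨k, l⟩
  rw [Matrix.mul_apply, Matrix.one_apply]
  have : ∀ p : Fin N × Fin N, flip21 (Rmat N) (i, j) p * Rinv N p (k, l) =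
      (if p = (i, j) then (if i = j then q else 1) * Rinv N p (k, l) else 0) +
      (if p = (j, i) then (if i < j then q - q⁻¹ else 0) * Rinv N p (k, l) else 0) := by
    rintro ⟨a, b⟩
    simp only [flip21, Rmat, Matrix.of_apply, Prod.mk.injEq]
    grind
  simp only [this, Finset.sum_add_distrib, Finset.sum_ite_eq', Finset.mem_univ, if_true]
  simp only [Rinv, Matrix.of_apply, Prod.mk.injEq]
  grind

lemma Rv_zero (N : ℕ) : Rv N 0 = Rmat N := rfl

lemma Rv_one (N : ℕ) : Rv N 1 = Rinv N := by
  simp only [Rv, one_ne_zero, if_false]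
  exact Matrix.inv_eq_right_inv (flip_mul_Rinv N)

/-- The fundamental representations of `𝒪_q(Mat_N)` given by the R-matrices `R₀`, `R₁`. -/
def fund (N : ℕ) (s : Fin 2) (d f : Fin N) : Matrix (Fin N) (Fin N) K :=
  Matrix.of fun e l => Rv N s (d, e) (f, l)

/-- The same entries with the roles of the tensor factors exchanged. -/
def cofund (N : ℕ) (s : Fin 2) (e l : Fin N) : Matrix (Fin N) (Fin N) K :=
  Matrix.of fun d f => Rv N s (d, e) (f, l)

lemma Rmat_sum_snd (N : ℕ) (d e f : Fin N) (g : Fin N → K) :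
    ∑ p, Rmat N (d, e) (f, p) * g p =
      (if d = f then (if d = e then q else 1) * g e else 0) +
      (if e = f then if e < d then (q - q⁻¹) * g d else 0 else 0) := by
  have : ∀ p, Rmat N (d, e) (f, p) * g p =
      (if p = e then (if d = f then (if d = e then q else 1) * g p else 0) else 0) +
      (if p = d then (if e = f then if e < d then (q - q⁻¹) * g p else 0 else 0) else 0) := by
    intro p
    simp only [Rmat, Matrix.of_apply]
    grind
  simp only [this, Finset.sum_add_distrib, Finset.sum_ite_eq', Finset.mem_univ, if_true]

lemma Rmat_sum_fst (N : ℕ) (d e l : Fin N) (g : Fin N → K) :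
    ∑ p, Rmat N (d, e) (p, l) * g p =
      (if e = l then (if d = e then q else 1) * g d else 0) +
      (if d = l then if e < d then (q - q⁻¹) * g e else 0 else 0) := by
  have : ∀ p, Rmat N (d, e) (p, l) * g p =
      (if p = d then (if e = l then (if d = e then q else 1) * g p else 0) else 0) +
      (if p = e then (if d = l then if e < d then (q - q⁻¹) * g p else 0 else 0) else 0) := by
    intro p
    simp only [Rmat, Matrix.of_apply]
    grind
  simp only [this, Finset.sum_add_distrib, Finset.sum_ite_eq', Finset.mem_univ, if_true]

lemma Rinv_sum_snd (N : ℕ) (d e f : Fin N) (g : Fin N → K) :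
    ∑ p, Rinv N (d, e) (f, p) * g p =
      (if d = f then (if d = e then q⁻¹ else 1) * g e else 0) +
      (if e = f then if d < e then (q⁻¹ - q) * g d else 0 else 0) := by
  have : ∀ p, Rinv N (d, e) (f, p) * g p =
      (if p = e then (if d = f then (if d = e then q⁻¹ else 1) * g p else 0) else 0) +
      (if p = d then (if e = f then if d < e then (q⁻¹ - q) * g p else 0 else 0) else 0) := by
    intro p
    simp only [Rinv, Matrix.of_apply]
    grind
  simp only [this, Finset.sum_add_distrib, Finset.sum_ite_eq', Finset.mem_univ, if_true]

lemma Rinv_sum_fst (N : ℕ) (d e l : Fin N) (g : Fin N → K) :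
    ∑ p, Rinv N (d, e) (p, l) * g p =
      (if e = l then (if d = e then q⁻¹ else 1) * g d else 0) +
      (if d = l then if d < e then (q⁻¹ - q) * g e else 0 else 0) := by
  have : ∀ p, Rinv N (d, e) (p, l) * g p =
      (if p = d then (if e = l then (if d = e then q⁻¹ else 1) * g p else 0) else 0) +
      (if p = e then (if d = l then if d < e then (q⁻¹ - q) * g p else 0 else 0) else 0) := by
    intro p
    simp only [Rinv, Matrix.of_apply]
    grind
  simp only [this, Finset.sum_add_distrib, Finset.sum_ite_eq', Finset.mem_univ, if_true]

lemma fund_zero_rtt (N : ℕ) : RTT (fund N 0) := by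
  intro f f' b b'
  have hq := q_ne_zero
  ext e l
  simp only [Matrix.add_apply, Matrix.smul_apply, Matrix.mul_apply, fund, Matrix.of_apply, Rv_zero,
    Rmat_sum_snd, smul_eq_mul]
  simp only [Rmat, Matrix.of_apply, rdiag, roff]
  have hp : q * q⁻¹ = 1 := mul_inv_cancel₀ hq
  generalize q⁻¹ = p at *
  generalize q = q at *
  by_cases h1 : f = b
  · subst h1
    by_cases h2 : f' = b'
    · subst h2
      grind (splits := 40)
    · grind (splits := 40)
  · by_cases h3 : f' = b
    · grind (splits := 40)
    · by_cases h2 : f' = b'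
      · grind (splits := 40)
      · by_cases h4 : e = b
        · grind (splits := 40)
        · grind (splits := 40)

lemma cofund_zero_rtt (N : ℕ) : RTT (fun e l => MulOpposite.op (cofund N 0 e l)) := by
  intro f f' b b'
  have hq := q_ne_zero
  simp only [← MulOpposite.op_mul, ← MulOpposite.op_smul, ← MulOpposite.op_add,
    MulOpposite.op_inj]
  ext e l
  simp only [Matrix.add_apply, Matrix.smul_apply, Matrix.mul_apply, cofund, Matrix.of_apply,
    Rv_zero, Rmat_sum_fst, smul_eq_mul]
  simp only [Rmat, Matrix.of_apply, rdiag, roff]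
  have hp : q * q⁻¹ = 1 := mul_inv_cancel₀ hq
  generalize q⁻¹ = p at *
  generalize q = q at *
  by_cases h1 : f = b
  · subst h1
    by_cases h2 : f' = b'
    · subst h2
      grind (splits := 40)
    · grind (splits := 40)
  · by_cases h3 : f' = b
    · grind (splits := 40)
    · by_cases h2 : f' = b'
      · grind (splits := 40)
      · by_cases h4 : e = b
        · grind (splits := 40)
        · grind (splits := 40)

lemma fund_one_rtt (N : ℕ) : RTT (fund N 1) := by
  intro f f' b b'
  have hq := q_ne_zero
  ext e l
  simp only [Matrix.add_apply, Matrix.smul_apply, Matrix.mul_apply, fund, Matrix.of_apply, Rv_one,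
    Rinv_sum_snd, smul_eq_mul]
  simp only [Rinv, Matrix.of_apply, rdiag, roff]
  have hp : q * q⁻¹ = 1 := mul_inv_cancel₀ hq
  generalize q⁻¹ = p at *
  generalize q = q at *
  by_cases h1 : f = b
  · subst h1
    by_cases h2 : f' = b'
    · subst h2
      grind (splits := 40)
    · grind (splits := 40)
  · by_cases h3 : f' = b
    · grind (splits := 40)
    · by_cases h2 : f' = b'
      · grind (splits := 40)
      · by_cases h4 : e = b
        · grind (splits := 40)
        · grind (splits := 40)

lemma cofund_one_rtt (N : ℕ) : RTT (fun e l => MulOpposite.op (cofund N 1 e l)) := by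
  intro f f' b b'
  have hq := q_ne_zero
  simp only [← MulOpposite.op_mul, ← MulOpposite.op_smul, ← MulOpposite.op_add,
    MulOpposite.op_inj]
  ext e l
  simp only [Matrix.add_apply, Matrix.smul_apply, Matrix.mul_apply, cofund, Matrix.of_apply,
    Rv_one, Rinv_sum_fst, smul_eq_mul]
  simp only [Rinv, Matrix.of_apply, rdiag, roff]
  have hp : q * q⁻¹ = 1 := mul_inv_cancel₀ hq
  generalize q⁻¹ = p at *
  generalize q = q at *
  by_cases h1 : f = b
  · subst h1
    by_cases h2 : f' = b'
    · subst h2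
      grind (splits := 40)
    · grind (splits := 40)
  · by_cases h3 : f' = b
    · grind (splits := 40)
    · by_cases h2 : f' = b'
      · grind (splits := 40)
      · by_cases h4 : e = b
        · grind (splits := 40)
        · grind (splits := 40)

lemma fund_rtt (N : ℕ) (s : Fin 2) : RTT (fund N s) := by
  fin_cases s
  exacts [fund_zero_rtt N, fund_one_rtt N]

lemma cofund_rtt (N : ℕ) (s : Fin 2) : RTT (fun e l => MulOpposite.op (cofund N s e l)) := by
  fin_cases s
  exacts [cofund_zero_rtt N, cofund_one_rtt N]

section OqMat

variable {N : ℕ}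

lemma tGen_qRel : QRel (tGen : Fin N → Fin N → OqMat N) where
  rowq l i j h := by
    have key := RingQuot.mkAlgHom_rel K (matRel.rowq l i j h)
    simp only [map_mul, map_smul] at key
    exact key
  colq l i j h := by
    have key := RingQuot.mkAlgHom_rel K (matRel.colq l i j h)
    simp only [map_mul, map_smul] at key
    exact key
  anti i k j l h1 h2 := by
    have key := RingQuot.mkAlgHom_rel K (matRel.anti i k j l h1 h2)
    simp only [map_mul] at key
    exact key
  main i k j l h1 h2 := by
    have key := RingQuot.mkAlgHom_rel K (matRel.main i k j l h1 h2)
    simp only [map_mul, map_smul, map_add] at key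
    exact key

lemma pGen_qRel : QRel (fun i j : Fin N => MulOpposite.op (pGen i j)) where
  rowq l i j h := by
    have key := RingQuot.mkAlgHom_rel K (matRelOp.rowq l i j h)
    simp only [map_mul, map_smul] at key
    exact congrArg MulOpposite.op key
  colq l i j h := by
    have key := RingQuot.mkAlgHom_rel K (matRelOp.colq l i j h)
    simp only [map_mul, map_smul] at key
    exact congrArg MulOpposite.op key
  anti i k j l h1 h2 := by
    have key := RingQuot.mkAlgHom_rel K (matRelOp.anti i k j l h1 h2)
    simp only [map_mul] at key
    exact congrArg MulOpposite.op key
  main i k j l h1 h2 := by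
    have key := RingQuot.mkAlgHom_rel K (matRelOp.main i k j l h1 h2)
    simp only [map_mul, map_smul, map_add] at key
    exact congrArg MulOpposite.op key

lemma QRel.lift_rel {S : Type*} [Ring S] [Algebra K S] {T : Fin N → Fin N → S} (h : QRel T)
    ⦃x y : FreeAlgebra K (Fin N × Fin N)⦄ (hxy : matRel N x y) :
    FreeAlgebra.lift K (fun p : Fin N × Fin N => T p.1 p.2) x =
      FreeAlgebra.lift K (fun p : Fin N × Fin N => T p.1 p.2) y := by
  induction hxy with
  | rowq l i j hij => simpa [Tg] using h.rowq l i j hij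
  | colq l i j hij => simpa [Tg] using h.colq l i j hij
  | anti i k j l h1 h2 => simpa [Tg] using h.anti i k j l h1 h2
  | main i k j l h1 h2 => simpa [Tg] using h.main i k j l h1 h2

lemma QRel.lift_rel_op {S : Type*} [Ring S] [Algebra K S] {T : Fin N → Fin N → S}
    (h : QRel fun i j => MulOpposite.op (T i j))
    ⦃x y : FreeAlgebra K (Fin N × Fin N)⦄ (hxy : matRelOp N x y) :
    FreeAlgebra.lift K (fun p : Fin N × Fin N => T p.1 p.2) x =
      FreeAlgebra.lift K (fun p : Fin N × Fin N => T p.1 p.2) y := by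
  induction hxy with
  | rowq l i j hij => simpa [Tg] using congrArg MulOpposite.unop (h.rowq l i j hij)
  | colq l i j hij => simpa [Tg] using congrArg MulOpposite.unop (h.colq l i j hij)
  | anti i k j l h1 h2 => simpa [Tg] using congrArg MulOpposite.unop (h.anti i k j l h1 h2)
  | main i k j l h1 h2 => simpa [Tg] using congrArg MulOpposite.unop (h.main i k j l h1 h2)

/-- The algebra homomorphism out of `𝒪_q(Mat_N)` defined by a family satisfying its relations. -/
def QRel.lift {S : Type} [Ring S] [Algebra K S] {T : Fin N → Fin N → S} (h : QRel T) :
    OqMat N →ₐ[K] S :=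
  RingQuot.liftAlgHom K ⟨FreeAlgebra.lift K (fun p => T p.1 p.2), h.lift_rel⟩

/-- The algebra homomorphism out of `𝒪_q(Mat_N)^op` defined by a family satisfying its
relations. -/
def QRel.liftOp {S : Type} [Ring S] [Algebra K S] {T : Fin N → Fin N → S}
    (h : QRel fun i j => MulOpposite.op (T i j)) : OqMatOp N →ₐ[K] S :=
  RingQuot.liftAlgHom K ⟨FreeAlgebra.lift K (fun p => T p.1 p.2), h.lift_rel_op⟩

@[simp]
lemma QRel.lift_tGen {S : Type} [Ring S] [Algebra K S] {T : Fin N → Fin N → S} (h : QRel T)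
    (i j : Fin N) : h.lift (tGen i j) = T i j := by
  simp [QRel.lift, tGen, Tg]

@[simp]
lemma QRel.liftOp_pGen {S : Type} [Ring S] [Algebra K S] {T : Fin N → Fin N → S}
    (h : QRel fun i j => MulOpposite.op (T i j)) (i j : Fin N) :
    h.liftOp (pGen i j) = T i j := by
  simp [QRel.liftOp, pGen, Tg]

lemma ringQuot_free_induction {X : Type} {r : FreeAlgebra K X → FreeAlgebra K X → Prop}
    {C : RingQuot r → Prop}
    (scalar : ∀ c : K, C (algebraMap K _ c))
    (gen : ∀ x, C (RingQuot.mkAlgHom K r (FreeAlgebra.ι K x)))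
    (mul : ∀ x y, C x → C y → C (x * y)) (add : ∀ x y, C x → C y → C (x + y))
    (x : RingQuot r) : C x := by
  obtain ⟨y, rfl⟩ := RingQuot.mkAlgHom_surjective K r x
  induction y with
  | grade0 c => simpa using scalar c
  | grade1 x => exact gen x
  | mul a b ha hb => rw [map_mul]; exact mul _ _ ha hb
  | add a b ha hb => rw [map_add]; exact add _ _ ha hb

end OqMat

section Coaction

variable {N : ℕ}

lemma entry_mul_comp {A : Type*} [Ring A] [Algebra K A]
    (Ψ Ψ' : A →ₐ[K] Matrix (Fin N) (Fin N) A) (x y : A) (e l e' l' : Fin N) :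
    Ψ' (Ψ (x * y) e l) e' l' =
      ∑ p, ∑ p', Ψ' (Ψ x e p) e' p' * Ψ' (Ψ y p l) p' l' := by
  rw [map_mul, Matrix.mul_apply, map_sum, Matrix.sum_apply]
  simp only [map_mul, Matrix.mul_apply]

lemma entry_algebraMap {A : Type*} [Ring A] [Algebra K A]
    (Ψ : A →ₐ[K] Matrix (Fin N) (Fin N) A) (c : K) (e l : Fin N) :
    Ψ (algebraMap K A c) e l = if e = l then algebraMap K A c else 0 := by
  rw [AlgHom.commutes, Matrix.algebraMap_matrix_apply]

lemma entry_entry_algebraMap {A : Type*} [Ring A] [Algebra K A]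
    (Ψ Ψ' : A →ₐ[K] Matrix (Fin N) (Fin N) A) (c : K) (e l e' l' : Fin N) :
    Ψ' (Ψ (algebraMap K A c) e l) e' l' =
      if e = l ∧ e' = l' then algebraMap K A c else 0 := by
  rw [entry_algebraMap]
  by_cases h : e = l
  · simp [h, entry_algebraMap]
  · simp [h]

/-- If the family `u` transforms under `Ψ` by an R-matrix, then the iterated entries of `Ψ` at
`u f` are invariant under exchange of index pairs. -/
lemma braided_of_transform {A : Type*} [Ring A] [Algebra K A] {s : Fin 2}
    (Ψ : A →ₐ[K] Matrix (Fin N) (Fin N) A) (u : Fin N → A)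
    (hu : ∀ f e l, Ψ (u f) e l = ∑ d, Rv N s (d, e) (f, l) • u d) (f : Fin N) :
    Braided fun e l e' l' => Ψ (Ψ (u f) e l) e' l' := by
  let φ : (Matrix (Fin N) (Fin N) K)ᵐᵒᵖ →ₗ[K] A :=
    (∑ c, (LinearMap.toSpanSingleton K A (u c)) ∘ₗ Matrix.entryLinearMap K K c f) ∘ₗ
      (MulOpposite.opLinearEquiv K).symm.toLinearMap
  have key := Braided.map (cofund_rtt N s) φ
  refine Eq.mp (congrArg Braided ?_) key
  funext e l e' l'
  simp only [φ, hu, map_sum, map_smul, Matrix.sum_apply, Matrix.smul_apply]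
  simp only [← MulOpposite.op_mul, LinearMap.comp_apply, LinearEquiv.coe_coe,
    MulOpposite.coe_opLinearEquiv_symm, MulOpposite.unop_op, LinearMap.sum_apply,
    Matrix.entryLinearMap_apply, LinearMap.toSpanSingleton_apply, Matrix.mul_apply, cofund,
    Matrix.of_apply, Finset.sum_smul, Finset.smul_sum, smul_smul]
  rw [Finset.sum_comm]
  refine Finset.sum_congr rfl fun _ _ => Finset.sum_congr rfl fun _ _ => ?_
  rw [mul_comm]

lemma braided_entry {Ψ : OqMat N →ₐ[K] Matrix (Fin N) (Fin N) (OqMat N)}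
    (hgen : ∀ f b, Braided fun e l e' l' => Ψ (Ψ (tGen f b) e l) e' l') (x : OqMat N) :
    Braided fun e l e' l' => Ψ (Ψ x e l) e' l' := by
  induction x using ringQuot_free_induction with
  | scalar c =>
    intro e e' l l'
    simp only [entry_entry_algebraMap, rdiag, roff]
    generalize algebraMap K (OqMat N) c = z
    by_cases h1 : e = e' <;> by_cases h2 : l = l' <;> by_cases h3 : e = l <;>
      by_cases h4 : e' = l' <;> by_cases h5 : e' = l <;> by_cases h6 : e = l' <;> simp_all
  | gen p => exact hgen p.1 p.2
  | mul x y hx hy => simpa only [entry_mul_comp] using hx.mul hy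
  | add x y hx hy => simpa only [map_add, Matrix.add_apply] using hx.add hy

/-- The entries of a matrix-valued homomorphism, as endomorphisms. -/
def entryEnd {A : Type*} [Ring A] [Algebra K A] (Ψ : A →ₐ[K] Matrix (Fin N) (Fin N) A)
    (e l : Fin N) : Module.End K A :=
  Matrix.entryLinearMap K A e l ∘ₗ Ψ.toLinearMap

@[simp]
lemma entryEnd_apply {A : Type*} [Ring A] [Algebra K A]
    (Ψ : A →ₐ[K] Matrix (Fin N) (Fin N) A) (e l : Fin N) (x : A) :
    entryEnd Ψ e l x = Ψ x e l := rfl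

lemma entryEnd_rtt {A : Type*} [Ring A] [Algebra K A] {Ψ : A →ₐ[K] Matrix (Fin N) (Fin N) A}
    (h : ∀ x, Braided fun e l e' l' => Ψ (Ψ x e l) e' l') :
    RTT fun e l => MulOpposite.op (entryEnd Ψ e l) := by
  intro e e' l l'
  refine MulOpposite.unop_injective (LinearMap.ext fun x => ?_)
  exact h x e e' l l'

lemma entry_comm {Ψ Ψ' : OqMat N →ₐ[K] Matrix (Fin N) (Fin N) (OqMat N)}
    (hgen : ∀ f b e l e' l',
      Ψ' (Ψ (tGen f b) e l) e' l' = Ψ (Ψ' (tGen f b) e' l') e l) (x : OqMat N) :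
    ∀ e l e' l', Ψ' (Ψ x e l) e' l' = Ψ (Ψ' x e' l') e l := by
  induction x using ringQuot_free_induction with
  | scalar c =>
    intro e l e' l'
    simp only [entry_entry_algebraMap, and_comm]
  | gen p => exact hgen p.1 p.2
  | mul x y hx hy =>
    intro e l e' l'
    rw [entry_mul_comp, entry_mul_comp, Finset.sum_comm]
    simp only [hx, hy]
  | add x y hx hy =>
    intro e l e' l'
    simp only [map_add, Matrix.add_apply, hx, hy]

lemma scalar_mul_map_comm {A : Type*} [Ring A] [Algebra K A] (a : A)
    (M : Matrix (Fin N) (Fin N) K) :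
    Matrix.scalar (Fin N) a * (Algebra.ofId K A).mapMatrix M =
      (Algebra.ofId K A).mapMatrix M * Matrix.scalar (Fin N) a := by
  ext e l
  simp [Matrix.scalar_apply, Matrix.diagonal_mul, Matrix.mul_diagonal, Algebra.ofId_apply,
    Algebra.commutes]

variable (N) in
lemma rowHom_rtt (s : Fin 2) :
    RTT fun f b => ∑ d, (Algebra.ofId K (OqMat N)).mapMatrix (fund N s d f) *
      Matrix.scalarAlgHom (Fin N) K (tGen d b) :=
  RTT.mul ((fund_rtt N s).transpose.map _) (tGen_qRel.rtt.map _)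
    fun _ _ _ _ => scalar_mul_map_comm _ _

variable (N) in
lemma colHom_rtt (s : Fin 2) :
    RTT fun f b => ∑ j, Matrix.scalarAlgHom (Fin N) K (tGen f j) *
      (Algebra.ofId K (OqMat N)).mapMatrix (fund N s j b) :=
  RTT.mul (tGen_qRel.rtt.map _) ((fund_rtt N s).map _)
    fun _ _ _ _ => (scalar_mul_map_comm _ _).symm

variable (N) in
/-- The coproduct of `𝒪_q(Mat_N)` with the first leg evaluated in a fundamental representation. -/
def rowHom (s : Fin 2) : OqMat N →ₐ[K] Matrix (Fin N) (Fin N) (OqMat N) :=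
  (rowHom_rtt N s).qRel.lift

variable (N) in
/-- The coproduct of `𝒪_q(Mat_N)` with the second leg evaluated in a fundamental
representation. -/
def colHom (s : Fin 2) : OqMat N →ₐ[K] Matrix (Fin N) (Fin N) (OqMat N) :=
  (colHom_rtt N s).qRel.lift

lemma rowHom_tGen (s : Fin 2) (f b e l : Fin N) :
    rowHom N s (tGen f b) e l = ∑ d, Rv N s (d, e) (f, l) • tGen d b := by
  simp [rowHom, Matrix.sum_apply, Matrix.scalar_apply, Matrix.mul_diagonal, fund,
    Algebra.ofId_apply, Algebra.smul_def]

lemma colHom_tGen (s : Fin 2) (f b a m : Fin N) :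
    colHom N s (tGen f b) a m = ∑ j, Rv N s (j, a) (b, m) • tGen f j := by
  simp [colHom, Matrix.sum_apply, Matrix.scalar_apply, Matrix.diagonal_mul, fund,
    Algebra.ofId_apply, Algebra.smul_def, Algebra.commutes]

lemma rowHom_entryEnd_rtt (s : Fin 2) :
    RTT fun e l => MulOpposite.op (entryEnd (rowHom N s) e l) :=
  entryEnd_rtt <| braided_entry fun f b => braided_of_transform (s := s) (rowHom N s)
    (fun d => tGen d b) (fun _ _ _ => rowHom_tGen _ _ _ _ _) f

lemma colHom_entryEnd_rtt (s : Fin 2) :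
    RTT fun e l => MulOpposite.op (entryEnd (colHom N s) e l) :=
  entryEnd_rtt <| braided_entry fun f b => braided_of_transform (s := s) (colHom N s)
    (fun j => tGen f j) (fun _ _ _ => colHom_tGen _ _ _ _ _) b

lemma colHom_rowHom_comm (υ σ : Fin 2) (x : OqMat N) (e l a m : Fin N) :
    colHom N υ (rowHom N σ x e l) a m = rowHom N σ (colHom N υ x a m) e l := by
  refine entry_comm (fun f b e l a m => ?_) x e l a m
  simp only [rowHom_tGen, colHom_tGen, map_sum, map_smul, Matrix.sum_apply, Matrix.smul_apply,
    Finset.smul_sum]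
  rw [Finset.sum_comm]
  refine Finset.sum_congr rfl fun _ _ => Finset.sum_congr rfl fun _ _ => ?_
  rw [smul_comm]

end Coaction

lemma sum_sum_comm {N : ℕ} {M : Type*} [AddCommMonoid M]
    (F : Fin N → Fin N → Fin N → Fin N → M) :
    ∑ a, ∑ b, ∑ c, ∑ d, F a b c d = ∑ c, ∑ d, ∑ a, ∑ b, F a b c d := by
  calc
    _ = ∑ a, ∑ c, ∑ d, ∑ b, F a b c d := Finset.sum_congr rfl fun a _ => by
      rw [Finset.sum_comm]
      exact Finset.sum_congr rfl fun c _ => Finset.sum_comm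
    _ = _ := by
      rw [Finset.sum_comm]
      exact Finset.sum_congr rfl fun c _ => Finset.sum_comm

section Twist

variable {N : ℕ} {A B : Type*} [Ring A] [Algebra K A] [Ring B] [Algebra K B]

/-- The operators on `A ⊗ B` that move an element `P e a` of `B` past the factor `A` by means of
the entries of two matrix-valued homomorphisms. -/
def twistOp (Ψ Ψ' : A →ₐ[K] Matrix (Fin N) (Fin N) A) (P : Fin N → Fin N → B) (e a : Fin N) :
    Module.End K (A ⊗[K] B) :=
  ∑ m, ∑ l, (entryEnd Ψ' a m).rTensor B *
    ((LinearMap.mulLeft K (P l m)).lTensor A * (entryEnd Ψ e l).rTensor B)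

lemma twistOp_tmul (Ψ Ψ' : A →ₐ[K] Matrix (Fin N) (Fin N) A) (P : Fin N → Fin N → B)
    (e a : Fin N) (x : A) (y : B) :
    twistOp Ψ Ψ' P e a (x ⊗ₜ y) = ∑ m, ∑ l, Ψ' (Ψ x e l) a m ⊗ₜ (P l m * y) := by
  simp [twistOp, LinearMap.sum_apply]

lemma twistOp_rtt {Ψ Ψ' : A →ₐ[K] Matrix (Fin N) (Fin N) A} {P : Fin N → Fin N → B}
    (hΨ : RTT fun e l => MulOpposite.op (entryEnd Ψ e l))
    (hΨ' : RTT fun e l => MulOpposite.op (entryEnd Ψ' e l))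
    (hP : RTT fun l m => MulOpposite.op (P l m))
    (hc : ∀ x e l a m, Ψ' (Ψ x e l) a m = Ψ (Ψ' x a m) e l) :
    RTT fun e a => MulOpposite.op (twistOp Ψ Ψ' P e a) := by
  have hrow := hΨ.map (AlgHom.op (Module.End.rTensorAlgHom K A B))
  have hcol := (hΨ'.map (AlgHom.op (Module.End.rTensorAlgHom K A B))).transpose
  have hmul := hP.map (AlgHom.op ((Module.End.lTensorAlgHom K B A).comp (Algebra.lmul K B)))
  have key := (hrow.mul hmul ?_).mul hcol ?_
  · refine Eq.mp (congrArg RTT ?_) key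
    funext e a
    refine MulOpposite.unop_injective ?_
    simp only [Finset.unop_sum, MulOpposite.unop_mul, twistOp, Finset.mul_sum]
    rfl
  · intro i j k l
    refine MulOpposite.unop_injective (TensorProduct.ext' fun x y => ?_)
    simp [TensorProduct.liftAux_tmul]
  · intro i j k l
    refine MulOpposite.unop_injective (TensorProduct.ext' fun x y => ?_)
    simp [Finset.unop_sum, LinearMap.sum_apply, TensorProduct.liftAux_tmul, hc]

variable (A B) in
/-- Left multiplication on the first factor of `A ⊗ B`. -/
def leftMul : A →ₐ[K] Module.End K (A ⊗[K] B) :=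
  (Module.End.rTensorAlgHom K A B).comp (Algebra.lmul K A)

lemma leftMul_tmul (a x : A) (y : B) : leftMul A B a (x ⊗ₜ y) = (a * x) ⊗ₜ y := rfl

lemma twistOp_mul_leftMul (Ψ Ψ' : A →ₐ[K] Matrix (Fin N) (Fin N) A) (P : Fin N → Fin N → B)
    (e a : Fin N) (t : A) :
    twistOp Ψ Ψ' P e a * leftMul A B t =
      ∑ l, ∑ m, leftMul A B (Ψ' (Ψ t e l) a m) * twistOp Ψ Ψ' P l m := by
  refine TensorProduct.ext' fun x y => ?_
  simp only [Module.End.mul_apply, LinearMap.sum_apply, leftMul_tmul, twistOp_tmul, map_sum,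
    entry_mul_comp, TensorProduct.sum_tmul]
  exact sum_sum_comm _

end Twist

section Action

variable {N : ℕ}

/-- The entries of the coaction of both fundamental representations on `𝒪_q(Mat_N)`. -/
def coentry (υ σ : Fin 2) (e a l m : Fin N) (x : OqMat N) : OqMat N :=
  colHom N υ (rowHom N σ x e l) a m

lemma coentry_mul (υ σ : Fin 2) (e a l m : Fin N) (x y : OqMat N) :
    coentry υ σ e a l m (x * y) =
      ∑ p, ∑ r, coentry υ σ e a p r x * coentry υ σ p r l m y :=
  entry_mul_comp _ _ _ _ _ _ _ _

lemma coentry_tGen (υ σ : Fin 2) (e a l m f b : Fin N) :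
    coentry υ σ e a l m (tGen f b) =
      ∑ d, ∑ j, (pt2 (Rv N σ) (d, l) (f, e) * pt2 (Rv N υ) (j, m) (b, a)) • tGen d j := by
  simp only [coentry, rowHom_tGen, colHom_tGen, map_sum, map_smul, Matrix.sum_apply,
    Matrix.smul_apply, Finset.smul_sum, smul_smul, pt2, Matrix.of_apply]

lemma sum_coentry_tGen_mul {S : Type*} [Semiring S] [Algebra K S] (υ σ : Fin 2)
    (φ : OqMat N →ₐ[K] S) (D : Fin N → Fin N → S) (e a f b : Fin N) :
    ∑ d, ∑ l, ∑ j, ∑ m, (pt2 (Rv N σ) (d, l) (f, e) * pt2 (Rv N υ) (j, m) (b, a)) •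
        (φ (tGen d j) * D l m) =
      ∑ l, ∑ m, φ (coentry υ σ e a l m (tGen f b)) * D l m := by
  simp only [coentry_tGen, map_sum, map_smul, Finset.sum_mul, smul_mul_assoc]
  rw [Finset.sum_comm]
  refine Finset.sum_congr rfl fun l _ => ?_
  rw [Finset.sum_congr rfl fun _ _ => Finset.sum_comm, Finset.sum_comm]

/-- The operator by which `∂_{ea}` acts on `𝒪_q(Mat_N) ⊗ 𝒪_q(Mat_N)^op`. -/
def derivOp (υ σ : Fin 2) (e a : Fin N) : Module.End K (OqMat N ⊗[K] OqMatOp N) :=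
  twistOp (rowHom N σ) (colHom N υ) pGen e a

/-- The action of the free algebra on `𝒪_q(Mat_N) ⊗ 𝒪_q(Mat_N)^op`. -/
def freeAction (N : ℕ) (υ σ : Fin 2) :
    FreeAlgebra K ((Fin N × Fin N) ⊕ (Fin N × Fin N)) →ₐ[K]
      Module.End K (OqMat N ⊗[K] OqMatOp N) :=
  FreeAlgebra.lift K (Sum.elim (fun p => leftMul (OqMat N) (OqMatOp N) (tGen p.1 p.2))
    fun p => derivOp υ σ p.1 p.2)

lemma freeAction_tF (υ σ : Fin 2) (i j : Fin N) :
    freeAction N υ σ (tF i j) = leftMul (OqMat N) (OqMatOp N) (tGen i j) := by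
  simp [freeAction, tF]

lemma freeAction_dF (υ σ : Fin 2) (i j : Fin N) :
    freeAction N υ σ (dF i j) = derivOp υ σ i j := by
  simp [freeAction, dF]

lemma freeAction_rel (υ σ : Fin 2)
    ⦃x y : FreeAlgebra K ((Fin N × Fin N) ⊕ (Fin N × Fin N))⦄ (h : ttRel N υ σ x y) :
    freeAction N υ σ x = freeAction N υ σ y := by
  have hD := (twistOp_rtt (rowHom_entryEnd_rtt (N := N) σ) (colHom_entryEnd_rtt υ) pGen_qRel.rtt
    (colHom_rowHom_comm υ σ)).qRel
  induction h with
  | trowq l i j h =>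
    simp only [map_mul, map_smul, freeAction_tF]
    simp only [← map_mul, ← map_smul, tGen_qRel.rowq l i j h]
  | tcolq l i j h =>
    simp only [map_mul, map_smul, freeAction_tF]
    simp only [← map_mul, ← map_smul, tGen_qRel.colq l i j h]
  | tanti i k j l h1 h2 =>
    simp only [map_mul, freeAction_tF]
    simp only [← map_mul, tGen_qRel.anti i k j l h1 h2]
  | tmain i k j l h1 h2 =>
    simp only [map_mul, map_add, map_smul, freeAction_tF]
    simp only [← map_mul, ← map_smul, ← map_add, tGen_qRel.main i k j l h1 h2]
  | drowq l i j h =>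
    simp only [map_mul, map_smul, freeAction_dF]
    exact congrArg MulOpposite.unop (hD.rowq l i j h)
  | dcolq l i j h =>
    simp only [map_mul, map_smul, freeAction_dF]
    exact congrArg MulOpposite.unop (hD.colq l i j h)
  | danti i k j l h1 h2 =>
    simp only [map_mul, freeAction_dF]
    exact congrArg MulOpposite.unop (hD.anti i k j l h1 h2)
  | dmain i k j l h1 h2 =>
    simp only [map_mul, map_add, map_smul, freeAction_dF]
    exact congrArg MulOpposite.unop (hD.main i k j l h1 h2)
  | cross e a f b =>
    simp only [map_mul, map_sum, map_smul, freeAction_tF, freeAction_dF]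
    rw [sum_coentry_tGen_mul]
    exact twistOp_mul_leftMul _ _ _ _ _ _

end Action

section TwistedTensor

variable {N : ℕ} {υ σ : Fin 2}

lemma tAtt_qRel : QRel (tAtt N υ σ) where
  rowq l i j h := by
    have key := RingQuot.mkAlgHom_rel K (ttRel.trowq (υ := υ) (σ := σ) l i j h)
    simp only [map_mul, map_smul] at key
    exact key
  colq l i j h := by
    have key := RingQuot.mkAlgHom_rel K (ttRel.tcolq (υ := υ) (σ := σ) l i j h)
    simp only [map_mul, map_smul] at key
    exact key
  anti i k j l h1 h2 := by
    have key := RingQuot.mkAlgHom_rel K (ttRel.tanti (υ := υ) (σ := σ) i k j l h1 h2)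
    simp only [map_mul] at key
    exact key
  main i k j l h1 h2 := by
    have key := RingQuot.mkAlgHom_rel K (ttRel.tmain (υ := υ) (σ := σ) i k j l h1 h2)
    simp only [map_mul, map_smul, map_add] at key
    exact key

lemma dAtt_qRel : QRel fun i j => MulOpposite.op (dAtt N υ σ i j) where
  rowq l i j h := by
    have key := RingQuot.mkAlgHom_rel K (ttRel.drowq (υ := υ) (σ := σ) l i j h)
    simp only [map_mul, map_smul] at key
    exact congrArg MulOpposite.op key
  colq l i j h := by
    have key := RingQuot.mkAlgHom_rel K (ttRel.dcolq (υ := υ) (σ := σ) l i j h)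
    simp only [map_mul, map_smul] at key
    exact congrArg MulOpposite.op key
  anti i k j l h1 h2 := by
    have key := RingQuot.mkAlgHom_rel K (ttRel.danti (υ := υ) (σ := σ) i k j l h1 h2)
    simp only [map_mul] at key
    exact congrArg MulOpposite.op key
  main i k j l h1 h2 := by
    have key := RingQuot.mkAlgHom_rel K (ttRel.dmain (υ := υ) (σ := σ) i k j l h1 h2)
    simp only [map_mul, map_smul, map_add] at key
    exact congrArg MulOpposite.op key

variable (N υ σ)

/-- The canonical map `𝒪_q(Mat_N) → 𝒜_{υσ}`. -/
def inclT : OqMat N →ₐ[K] Att N υ σ := tAtt_qRel.lift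

/-- The canonical map `𝒪_q(Mat_N)^op → 𝒜_{υσ}`. -/
def inclD : OqMatOp N →ₐ[K] Att N υ σ := dAtt_qRel.liftOp

/-- The multiplication map `𝒪_q(Mat_N) ⊗ 𝒪_q(Mat_N)^op → 𝒜_{υσ}`. -/
def mulMap : OqMat N ⊗[K] OqMatOp N →ₗ[K] Att N υ σ :=
  LinearMap.mul' K (Att N υ σ) ∘ₗ
    TensorProduct.map (inclT N υ σ).toLinearMap (inclD N υ σ).toLinearMap

/-- The action of `𝒜_{υσ}` on `𝒪_q(Mat_N) ⊗ 𝒪_q(Mat_N)^op`. -/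
def action : Att N υ σ →ₐ[K] Module.End K (OqMat N ⊗[K] OqMatOp N) :=
  RingQuot.liftAlgHom K ⟨freeAction N υ σ, freeAction_rel υ σ⟩

variable {N}

lemma inclT_tGen (i j : Fin N) : inclT N υ σ (tGen i j) = tAtt N υ σ i j := by
  simp [inclT]

lemma inclD_pGen (i j : Fin N) : inclD N υ σ (pGen i j) = dAtt N υ σ i j := by
  simp [inclD]

lemma mulMap_tmul (x : OqMat N) (y : OqMatOp N) :
    mulMap N υ σ (x ⊗ₜ y) = inclT N υ σ x * inclD N υ σ y := by
  simp [mulMap]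

lemma action_tAtt (i j : Fin N) :
    action N υ σ (tAtt N υ σ i j) = leftMul (OqMat N) (OqMatOp N) (tGen i j) := by
  rw [action, tAtt, RingQuot.liftAlgHom_mkAlgHom_apply, freeAction_tF]

lemma action_dAtt (i j : Fin N) : action N υ σ (dAtt N υ σ i j) = derivOp υ σ i j := by
  rw [action, dAtt, RingQuot.liftAlgHom_mkAlgHom_apply, freeAction_dF]

lemma action_inclT (x : OqMat N) :
    action N υ σ (inclT N υ σ x) = leftMul (OqMat N) (OqMatOp N) x := by
  induction x using ringQuot_free_induction with
  | scalar c => simp only [AlgHom.commutes]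
  | gen p =>
    change action N υ σ (inclT N υ σ (tGen p.1 p.2)) = leftMul _ _ (tGen p.1 p.2)
    rw [inclT_tGen, action_tAtt]
  | mul x y hx hy => simp only [map_mul, hx, hy]
  | add x y hx hy => simp only [map_add, hx, hy]

lemma derivOp_one_tmul (e a : Fin N) (y : OqMatOp N) :
    derivOp υ σ e a (1 ⊗ₜ y) = 1 ⊗ₜ (pGen e a * y) := by
  have h (l m : Fin N) : colHom N υ (rowHom N σ 1 e l) a m = if e = l ∧ a = m then 1 else 0 := by
    simpa only [map_one] using entry_entry_algebraMap (rowHom N σ) (colHom N υ) 1 e l a m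
  rw [derivOp, twistOp_tmul]
  simp only [h]
  rw [Finset.sum_eq_single a, Finset.sum_eq_single e]
  · simp
  · intro l _ hl
    simp [hl.symm]
  · simp
  · intro m _ hm
    simp [hm.symm]
  · simp

lemma action_inclD_one_tmul (g y : OqMatOp N) :
    action N υ σ (inclD N υ σ g) (1 ⊗ₜ y) = 1 ⊗ₜ (g * y) := by
  induction g using ringQuot_free_induction generalizing y with
  | scalar c =>
    rw [AlgHom.commutes, AlgHom.commutes, Module.algebraMap_end_apply, ← Algebra.smul_def,
      TensorProduct.tmul_smul]
  | gen p =>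
    change action N υ σ (inclD N υ σ (pGen p.1 p.2)) _ = _ ⊗ₜ (pGen p.1 p.2 * y)
    rw [inclD_pGen, action_dAtt, derivOp_one_tmul]
  | mul x x' hx hx' => rw [map_mul, map_mul, Module.End.mul_apply, hx', hx, mul_assoc]
  | add x x' hx hx' =>
    rw [map_add, map_add, LinearMap.add_apply, hx, hx', add_mul, TensorProduct.tmul_add]

lemma action_mulMap (z : OqMat N ⊗[K] OqMatOp N) :
    action N υ σ (mulMap N υ σ z) (1 ⊗ₜ 1) = z := by
  induction z with
  | zero => simp only [map_zero, LinearMap.zero_apply]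
  | tmul x y =>
    rw [mulMap_tmul, map_mul, Module.End.mul_apply, action_inclD_one_tmul, action_inclT,
      leftMul_tmul, mul_one, mul_one]
  | add x y hx hy => rw [map_add, map_add, LinearMap.add_apply, hx, hy]

lemma dAtt_mul_inclT (x : OqMat N) (e a : Fin N) :
    dAtt N υ σ e a * inclT N υ σ x =
      ∑ l, ∑ m, inclT N υ σ (coentry υ σ e a l m x) * dAtt N υ σ l m := by
  induction x using ringQuot_free_induction generalizing e a with
  | scalar c =>
    simp only [coentry, entry_entry_algebraMap]
    rw [Finset.sum_eq_single e, Finset.sum_eq_single a]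
    · simp [Algebra.commutes]
    · intro m _ hm
      simp [hm.symm]
    · simp
    · intro l _ hl
      simp [hl.symm]
    · simp
  | gen p =>
    change _ * inclT N υ σ (tGen p.1 p.2) = ∑ l, ∑ m, inclT N υ σ (coentry υ σ e a l m
      (tGen p.1 p.2)) * _
    rw [← sum_coentry_tGen_mul]
    simp only [inclT_tGen]
    have key := RingQuot.mkAlgHom_rel K (ttRel.cross (υ := υ) (σ := σ) e a p.1 p.2)
    simp only [map_mul, map_sum, map_smul] at key
    exact key
  | mul x y hx hy =>
    rw [map_mul, ← mul_assoc, hx]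
    simp only [Finset.sum_mul, mul_assoc, hy, Finset.mul_sum, coentry_mul, map_sum, map_mul]
    exact sum_sum_comm _
  | add x y hx hy =>
    simp only [map_add, mul_add, hx, hy, coentry, Matrix.add_apply, add_mul,
      Finset.sum_add_distrib]

lemma mulMap_action (u : Att N υ σ) (z : OqMat N ⊗[K] OqMatOp N) :
    mulMap N υ σ (action N υ σ u z) = u * mulMap N υ σ z := by
  induction u using ringQuot_free_induction generalizing z with
  | scalar c =>
    rw [AlgHom.commutes, Module.algebraMap_end_apply, map_smul, Algebra.smul_def]
  | gen p =>
    induction z with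
    | zero => simp only [map_zero, mul_zero]
    | add z z' hz hz' => simp only [map_add, mul_add, hz, hz']
    | tmul x y =>
      rcases p with p | p
      · change mulMap N υ σ (action N υ σ (tAtt N υ σ p.1 p.2) _) = tAtt N υ σ p.1 p.2 * _
        rw [action_tAtt, leftMul_tmul, mulMap_tmul, mulMap_tmul, map_mul, inclT_tGen, mul_assoc]
      · change mulMap N υ σ (action N υ σ (dAtt N υ σ p.1 p.2) _) = dAtt N υ σ p.1 p.2 * _
        rw [action_dAtt, derivOp, twistOp_tmul, mulMap_tmul, ← mul_assoc, dAtt_mul_inclT,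
          Finset.sum_comm]
        simp only [map_sum, mulMap_tmul, map_mul, inclD_pGen, Finset.sum_mul, mul_assoc, coentry]
  | mul x y hx hy => rw [map_mul, Module.End.mul_apply, hx, hy, mul_assoc]
  | add x y hx hy => rw [map_add, LinearMap.add_apply, map_add, hx, hy, add_mul]

lemma mulMap_bijective : Function.Bijective (mulMap N υ σ) := by
  refine ⟨Function.LeftInverse.injective
    (g := fun u => action N υ σ u (1 ⊗ₜ 1)) (action_mulMap υ σ), fun u =>
    ⟨action N υ σ u (1 ⊗ₜ 1), ?_⟩⟩
  rw [mulMap_action, mulMap_tmul, map_one, map_one, mul_one, mul_one]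

end TwistedTensor

theorem stmt13 (N : ℕ) (hN : 1 ≤ N) (υ σ : Fin 2) :
    ∃ (φT : OqMat N →ₐ[K] Att N υ σ) (φD : OqMatOp N →ₐ[K] Att N υ σ),
      (∀ i j : Fin N, φT (tGen i j) = tAtt N υ σ i j) ∧
      (∀ i j : Fin N, φD (pGen i j) = dAtt N υ σ i j) ∧
      Function.Bijective
        (LinearMap.mul' K (Att N υ σ) ∘ₗ
          TensorProduct.map φT.toLinearMap φD.toLinearMap) :=
  ⟨inclT N υ σ, inclD N υ σ, inclT_tGen υ σ, inclD_pGen υ σ, mulMap_bijective υ σ⟩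
end
end

section
/- In 𝒜^θ₀₀ (Type AI), for all indices with 1 ≤ a ≤ b ≤ n and 1 ≤ e ≤ f ≤ n, the element d_{ab} x_{ef} − q^{δ_{af} + δ_{ae} + δ_{bf} + δ_{be}} x_{ef} d_{ab} lies in the k-linear span of the elements x_{e'f'} d_{a'b'} with e' ≥ e, f' ≥ f, a' ≥ a, b' ≥ b and at least one of these four inequalities strict. -/
open scoped BigOperators TensorProduct

noncomputable section

/-- the generator `x_{ij}` inside the big free algebra -/
def XgS {n : ℕ} (i j : Fin n) : FreeAlgebra K ((Fin n × Fin n) ⊕ (Fin n × Fin n)) :=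
  FreeAlgebra.ι K (Sum.inl (i, j))

/-- the generator `d_{ij}` inside the big free algebra -/
def DgS {n : ℕ} (i j : Fin n) : FreeAlgebra K ((Fin n × Fin n) ⊕ (Fin n × Fin n)) :=
  FreeAlgebra.ι K (Sum.inr (i, j))

/-- the R-matrix with entries viewed in the big free algebra -/
def RfS (n : ℕ) :
    Matrix (Fin n × Fin n) (Fin n × Fin n) (FreeAlgebra K ((Fin n × Fin n) ⊕ (Fin n × Fin n))) :=
  (Rmat n).map fun x => algebraMap K (FreeAlgebra K ((Fin n × Fin n) ⊕ (Fin n × Fin n))) x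

/-- the matrix `D₁ = D ⊗ I` of `d`-generators in the big free algebra -/
def D1S (n : ℕ) :
    Matrix (Fin n × Fin n) (Fin n × Fin n) (FreeAlgebra K ((Fin n × Fin n) ⊕ (Fin n × Fin n))) :=
  Matrix.of fun p c => if p.2 = c.2 then DgS p.1 c.1 else 0

/-- the matrix `D₂ = I ⊗ D` of `d`-generators in the big free algebra -/
def D2S (n : ℕ) :
    Matrix (Fin n × Fin n) (Fin n × Fin n) (FreeAlgebra K ((Fin n × Fin n) ⊕ (Fin n × Fin n))) :=
  Matrix.of fun p c => if p.1 = c.1 then DgS p.2 c.2 else 0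

/-- the defining relations of the twisted tensor product algebra `𝒜^θ_{αυ}` (Type AI) -/
inductive aThRel (n : ℕ) (α υ : Fin 2) :
    FreeAlgebra K ((Fin n × Fin n) ⊕ (Fin n × Fin n)) →
      FreeAlgebra K ((Fin n × Fin n) ⊕ (Fin n × Fin n)) → Prop
  | psym (i j : Fin n) (h : i < j) : aThRel n α υ (XgS i j) (q • XgS j i)
  | prefl (l d h k : Fin n) :
      aThRel n α υ
        (∑ j : Fin n, ∑ s : Fin n, ∑ a : Fin n, ∑ v : Fin n,
          (Rmat n (l, d) (j, s) * Rmat n (h, s) (a, v)) • (XgS j a * XgS v k))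
        (∑ s : Fin n, ∑ a : Fin n, ∑ b : Fin n, ∑ u : Fin n,
          (Rmat n (a, s) (l, b) * Rmat n (u, b) (h, k)) • (XgS d s * XgS a u))
  | dsym (i j : Fin n) (h : i < j) : aThRel n α υ (DgS i j) (q⁻¹ • DgS j i)
  | drefl (p c : Fin n × Fin n) :
      aThRel n α υ ((RfS n * D2S n * pt1 (RfS n) * D1S n) p c)
                   ((D1S n * pt1 (RfS n) * D2S n * RfS n) p c)
  | cross (a b e f : Fin n) :
      aThRel n α υ (DgS a b * XgS e f)
        (∑ r : Fin n, ∑ w : Fin n, ∑ pp : Fin n, ∑ cc : Fin n,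
          ∑ z : Fin n, ∑ y : Fin n, ∑ m : Fin n, ∑ l : Fin n,
          (pt2 (Rv n α) (w, r) (z, cc) * pt2 (Rv n α) (pp, cc) (m, a) *
            pt2 (Rv n υ) (z, y) (f, l) * pt2 (Rv n υ) (m, l) (e, b)) • (XgS pp w * DgS r y))

/-- the twisted tensor product algebra `𝒜^θ_{αυ}` (Type AI) -/
abbrev ATh (n : ℕ) (α υ : Fin 2) := RingQuot (aThRel n α υ)

/-- the class of `x_{ij}` in `𝒜^θ_{αυ}` -/
def xTh (n : ℕ) (α υ : Fin 2) (i j : Fin n) : ATh n α υ :=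
  RingQuot.mkAlgHom K (aThRel n α υ) (XgS i j)

/-- the class of `d_{ij}` in `𝒜^θ_{αυ}` -/
def dTh (n : ℕ) (α υ : Fin 2) (i j : Fin n) : ATh n α υ :=
  RingQuot.mkAlgHom K (aThRel n α υ) (DgS i j)

lemma pt2_Rmat_diag {N : ℕ} (i j : Fin N) :
    pt2 (Rmat N) (i, j) (i, j) = q ^ (if i = j then 1 else 0 : ℕ) := by
  by_cases h : i = j <;> simp [pt2, Rmat, h]

lemma le_of_pt2_Rmat_ne_zero {N : ℕ} {i j k l : Fin N}
    (h : pt2 (Rmat N) (i, j) (k, l) ≠ 0) : k ≤ i ∧ l ≤ j := by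
  simp only [pt2, Rmat, Matrix.of_apply] at h
  split_ifs at h with h₁ h₂ h₃
  · exact ⟨h₁.1.ge, h₁.2.le⟩
  · exact ⟨h₁.1.ge, h₁.2.le⟩
  · exact ⟨h₃.2.2.le, by rw [h₃.2.1, ← h₃.1]; exact h₃.2.2.le⟩
  · exact absurd rfl h

lemma Submodule.sum_sub_mem_of_ne {R M ι : Type*} [Ring R] [AddCommGroup M] [Module R M]
    [Fintype ι] (S : Submodule R M) (F : ι → M) (t : M) (i₀ : ι)
    (h : ∀ i, i ≠ i₀ → F i ∈ S) (h₀ : F i₀ - t ∈ S) : ∑ i, F i - t ∈ S := by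
  classical
  rw [← Finset.add_sum_erase _ _ (Finset.mem_univ i₀), add_sub_right_comm]
  exact S.add_mem h₀ (S.sum_mem fun i hi => h i (Finset.ne_of_mem_erase hi))

lemma dTh_mul_xTh (n : ℕ) (a b e f : Fin n) :
    dTh n 0 0 a b * xTh n 0 0 e f =
      ∑ r : Fin n, ∑ w : Fin n, ∑ pp : Fin n, ∑ cc : Fin n,
        ∑ z : Fin n, ∑ y : Fin n, ∑ m : Fin n, ∑ l : Fin n,
        (pt2 (Rmat n) (w, r) (z, cc) * pt2 (Rmat n) (pp, cc) (m, a) *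
          pt2 (Rmat n) (z, y) (f, l) * pt2 (Rmat n) (m, l) (e, b)) •
            (xTh n 0 0 pp w * dTh n 0 0 r y) := by
  have h := RingQuot.mkAlgHom_rel K (aThRel.cross (n := n) (α := 0) (υ := 0) a b e f)
  simpa only [map_mul, map_sum, map_smul, Rv, if_true, xTh, dTh] using h

theorem stmt16 (n : ℕ) (a b e f : Fin n) (hab : a ≤ b) (hef : e ≤ f) :
    dTh n 0 0 a b * xTh n 0 0 e f -
      (q ^ (((if a = f then 1 else 0) + (if a = e then 1 else 0) +
        (if b = f then 1 else 0) + (if b = e then 1 else 0) : ℕ))) •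
        (xTh n 0 0 e f * dTh n 0 0 a b) ∈
      Submodule.span K
        {w : ATh n 0 0 | ∃ e' f' a' b' : Fin n,
          (e ≤ e' ∧ f ≤ f' ∧ a ≤ a' ∧ b ≤ b' ∧ (e < e' ∨ f < f' ∨ a < a' ∨ b < b')) ∧
          w = xTh n 0 0 e' f' * dTh n 0 0 a' b'} := by
  set S := Submodule.span K
    {w : ATh n 0 0 | ∃ e' f' a' b' : Fin n,
      (e ≤ e' ∧ f ≤ f' ∧ a ≤ a' ∧ b ≤ b' ∧ (e < e' ∨ f < f' ∨ a < a' ∨ b < b')) ∧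
      w = xTh n 0 0 e' f' * dTh n 0 0 a' b'}
  have term_mem : ∀ r w pp cc z y m l : Fin n,
      ¬(r = a ∧ w = f ∧ pp = e ∧ cc = a ∧ z = f ∧ y = b ∧ m = e ∧ l = b) →
      (pt2 (Rmat n) (w, r) (z, cc) * pt2 (Rmat n) (pp, cc) (m, a) *
        pt2 (Rmat n) (z, y) (f, l) * pt2 (Rmat n) (m, l) (e, b)) •
          (xTh n 0 0 pp w * dTh n 0 0 r y) ∈ S := by
    intro r w pp cc z y m l hne
    by_cases h₀ : pt2 (Rmat n) (w, r) (z, cc) * pt2 (Rmat n) (pp, cc) (m, a) *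
        pt2 (Rmat n) (z, y) (f, l) * pt2 (Rmat n) (m, l) (e, b) = 0
    · rw [h₀, zero_smul]
      exact S.zero_mem
    simp only [mul_eq_zero, not_or] at h₀
    obtain ⟨⟨⟨h₁, h₂⟩, h₃⟩, h₄⟩ := h₀
    have h₁ := le_of_pt2_Rmat_ne_zero h₁
    have h₂ := le_of_pt2_Rmat_ne_zero h₂
    have h₃ := le_of_pt2_Rmat_ne_zero h₃
    have h₄ := le_of_pt2_Rmat_ne_zero h₄
    exact S.smul_mem _ (Submodule.subset_span ⟨pp, w, r, y, by omega, rfl⟩)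
  rw [dTh_mul_xTh]
  refine S.sum_sub_mem_of_ne _ _ a (fun r hr => ?_) ?_
  · exact S.sum_mem fun w _ => S.sum_mem fun pp _ => S.sum_mem fun cc _ => S.sum_mem fun z _ =>
      S.sum_mem fun y _ => S.sum_mem fun m _ => S.sum_mem fun l _ =>
        term_mem _ _ _ _ _ _ _ _ (by tauto)
  refine S.sum_sub_mem_of_ne _ _ f (fun w hw => ?_) ?_
  · exact S.sum_mem fun pp _ => S.sum_mem fun cc _ => S.sum_mem fun z _ =>
      S.sum_mem fun y _ => S.sum_mem fun m _ => S.sum_mem fun l _ =>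
        term_mem _ _ _ _ _ _ _ _ (by tauto)
  refine S.sum_sub_mem_of_ne _ _ e (fun pp hpp => ?_) ?_
  · exact S.sum_mem fun cc _ => S.sum_mem fun z _ => S.sum_mem fun y _ => S.sum_mem fun m _ =>
      S.sum_mem fun l _ => term_mem _ _ _ _ _ _ _ _ (by tauto)
  refine S.sum_sub_mem_of_ne _ _ a (fun cc hcc => ?_) ?_
  · exact S.sum_mem fun z _ => S.sum_mem fun y _ => S.sum_mem fun m _ => S.sum_mem fun l _ =>
      term_mem _ _ _ _ _ _ _ _ (by tauto)
  refine S.sum_sub_mem_of_ne _ _ f (fun z hz => ?_) ?_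
  · exact S.sum_mem fun y _ => S.sum_mem fun m _ => S.sum_mem fun l _ =>
      term_mem _ _ _ _ _ _ _ _ (by tauto)
  refine S.sum_sub_mem_of_ne _ _ b (fun y hy => ?_) ?_
  · exact S.sum_mem fun m _ => S.sum_mem fun l _ => term_mem _ _ _ _ _ _ _ _ (by tauto)
  refine S.sum_sub_mem_of_ne _ _ e (fun m hm => ?_) ?_
  · exact S.sum_mem fun l _ => term_mem _ _ _ _ _ _ _ _ (by tauto)
  refine S.sum_sub_mem_of_ne _ _ b (fun l hl => term_mem _ _ _ _ _ _ _ _ (by tauto)) ?_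
  convert S.zero_mem using 1
  rw [sub_eq_zero]
  simp only [pt2_Rmat_diag, ← pow_add, eq_comm (a := f), eq_comm (a := e)]
end
end
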